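/- For every h ∈ (−1,0), the derivatives of Ī₀ and Ī₂ are given by the trigonometric integrals Ī₀′(h) = (1/4) ∫_0^π (1 − √(1+h) cos θ)^{−1/2} dθ and Ī₂′(h) = (1/4) ∫_0^π (1 − √(1+h) cos θ)^{1/2} dθ. -/

import Mathlib

open intervalIntegral Real

/-- `Ī_k(h) = ∫_{u₁(h)}^{u₂(h)} u^k √(h + 2u² − u⁴) du` where
`u₁(h) = √(1 − √(1+h))` and `u₂(h) = √(1 + √(1+h))`. -/
noncomputable def Ibar (k : ℕ) (h : ℝ) : ℝ :=
  ∫ u in (Real.sqrt (1 - Real.sqrt (1 + h)))..(Real.sqrt (1 + Real.sqrt (1 + h))),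
    u ^ k * Real.sqrt (h + 2 * u ^ 2 - u ^ 4)

/-- The base `1 - s cos θ` is positive for `s ∈ [0,1)`. -/
lemma one_sub_mul_cos_pos {s : ℝ} (hs0 : 0 ≤ s) (hs1 : s < 1) (θ : ℝ) :
    0 < 1 - s * cos θ := by
  nlinarith [cos_le_one θ, neg_one_le_cos θ]

lemma continuousOn_one_sub_mul_cos_rpow (p : ℝ) :
    ContinuousOn (fun x : ℝ × ℝ => (1 - x.1 * cos x.2) ^ p) (Set.Ico 0 1 ×ˢ Set.univ) := by
  refine ContinuousOn.rpow_const (by fun_prop) fun x hx => Or.inl ?_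
  exact (one_sub_mul_cos_pos hx.1.1 hx.1.2 _).ne'

lemma continuous_one_sub_mul_cos_rpow {s : ℝ} (hs0 : 0 ≤ s) (hs1 : s < 1) (p : ℝ) :
    Continuous fun θ : ℝ => (1 - s * cos θ) ^ p :=
  Continuous.rpow_const (by fun_prop) fun θ => Or.inl (one_sub_mul_cos_pos hs0 hs1 θ).ne'

/-- Trigonometric form of `Ibar`, from the substitution `u² = 1 - √(1+h) cos θ`. -/
lemma Ibar_eq_integral_sin_sq (k : ℕ) {h : ℝ} (hh : h ∈ Set.Ioo (-1 : ℝ) 0) :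
    Ibar k h = (√(1 + h)) ^ 2 / 2 *
      ∫ θ in (0 : ℝ)..π, sin θ ^ 2 * (1 - √(1 + h) * cos θ) ^ (((k : ℝ) - 1) / 2) := by
  have hsq : √(1 + h) ^ 2 = 1 + h := sq_sqrt (by linarith [hh.1])
  have hs0 : 0 ≤ √(1 + h) := sqrt_nonneg _
  have hs1 : √(1 + h) < 1 := by
    rw [sqrt_lt' one_pos]; linarith [hh.2]
  unfold Ibar
  generalize √(1 + h) = s at *
  have hw := one_sub_mul_cos_pos hs0 hs1
  have key := integral_comp_mul_deriv (a := 0) (b := π) (f := fun θ => √(1 - s * cos θ))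
    (f' := fun θ => s * sin θ / (2 * √(1 - s * cos θ)))
    (g := fun u => u ^ k * √(h + 2 * u ^ 2 - u ^ 4))
    (fun θ _ => by
      have := (((hasDerivAt_cos θ).const_mul s).const_sub 1).sqrt (hw θ).ne'
      simpa using this)
    (Continuous.continuousOn <| by
      refine Continuous.div (by fun_prop) (by fun_prop) fun θ => ?_
      have := sqrt_pos.2 (hw θ)
      positivity)
    (by fun_prop)
  simp only [cos_zero, cos_pi, mul_one, mul_neg, sub_neg_eq_add] at key
  rw [← key, ← integral_const_mul]
  refine integral_congr fun θ hθ => ?_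
  rw [Set.uIcc_of_le pi_pos.le] at hθ
  have hsin := sin_nonneg_of_mem_Icc hθ
  have hr := sqrt_pos.2 (hw θ)
  have hr2 : √(1 - s * cos θ) ^ 2 = 1 - s * cos θ := sq_sqrt (hw θ).le
  have hroot : √(h + 2 * √(1 - s * cos θ) ^ 2 - √(1 - s * cos θ) ^ 4) = s * sin θ := by
    rw [show √(1 - s * cos θ) ^ 4 = (√(1 - s * cos θ) ^ 2) ^ 2 by ring, hr2,
      show h + 2 * (1 - s * cos θ) - (1 - s * cos θ) ^ 2 = (s * sin θ) ^ 2 by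
        rw [mul_pow, sin_sq]; linear_combination -hsq]
    exact sqrt_sq (mul_nonneg hs0 hsin)
  have hpow : (1 - s * cos θ) ^ (((k : ℝ) - 1) / 2)
      = √(1 - s * cos θ) ^ k / √(1 - s * cos θ) := by
    rw [← rpow_natCast, sqrt_eq_rpow, ← rpow_mul (hw θ).le, ← rpow_sub (hw θ)]
    congr 1; ring
  simp only [Function.comp_apply, hroot, hpow]
  field_simp

/-- Integration by parts against `sin θ cos θ`. -/
lemma integral_sin_sq_mul_cos_rpow {s : ℝ} (hs0 : 0 ≤ s) (hs1 : s < 1) (p : ℝ) :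
    ∫ θ in (0 : ℝ)..π, ((cos θ ^ 2 - sin θ ^ 2) * (1 - s * cos θ) ^ p
      + s * (sin θ ^ 2 * (cos θ * (p * (1 - s * cos θ) ^ (p - 1))))) = 0 := by
  have hc := continuous_one_sub_mul_cos_rpow hs0 hs1
  rw [integral_eq_sub_of_hasDerivAt (f := fun θ => sin θ * cos θ * (1 - s * cos θ) ^ p)]
  · simp
  · intro θ _
    have h1 := (hasDerivAt_sin θ).mul (hasDerivAt_cos θ)
    have h2 := (((hasDerivAt_cos θ).const_mul s).const_sub 1).rpow_const (p := p)
      (Or.inl (one_sub_mul_cos_pos hs0 hs1 θ).ne')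
    refine (h1.mul h2).congr_deriv ?_
    simp only [Pi.mul_apply]
    ring
  · have := hc p
    have := hc (p - 1)
    exact Continuous.intervalIntegrable (by fun_prop) _ _

lemma hasDerivAt_integral_sin_sq_rpow {s : ℝ} (hs0 : 0 < s) (hs1 : s < 1) (p : ℝ) :
    HasDerivAt (fun s => ∫ θ in (0 : ℝ)..π, sin θ ^ 2 * (1 - s * cos θ) ^ p)
      (∫ θ in (0 : ℝ)..π, -(sin θ ^ 2 * (cos θ * (p * (1 - s * cos θ) ^ (p - 1))))) s := by
  obtain ⟨b, hsb, hb1⟩ := exists_between hs1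
  have hcont : ContinuousOn
      (fun x : ℝ × ℝ => -(sin x.2 ^ 2 * (cos x.2 * (p * (1 - x.1 * cos x.2) ^ (p - 1)))))
      (Set.Icc 0 b ×ˢ Set.Icc 0 π) := by
    have := (continuousOn_one_sub_mul_cos_rpow (p - 1)).mono
      (Set.prod_mono (Set.Icc_subset_Ico_right hb1) (Set.subset_univ (Set.Icc 0 π)))
    fun_prop
  obtain ⟨C, hC⟩ := (isCompact_Icc.prod isCompact_Icc).exists_bound_of_continuousOn hcont
  have hc {t : ℝ} (ht : t ∈ Set.Ioo 0 b) := continuous_one_sub_mul_cos_rpow ht.1.le (ht.2.trans hb1)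
  have hmem : Set.Ioo 0 b ∈ nhds s := Ioo_mem_nhds hs0 hsb
  refine (intervalIntegral.hasDerivAt_integral_of_dominated_loc_of_deriv_le (bound := fun _ => C)
    (F := fun t θ => sin θ ^ 2 * (1 - t * cos θ) ^ p)
    (F' := fun t θ => -(sin θ ^ 2 * (cos θ * (p * (1 - t * cos θ) ^ (p - 1))))) hmem
    ?_ ?_ ?_ ?_ ?_ ?_).2
  · filter_upwards [hmem] with t ht
    have := hc ht p
    exact Continuous.aestronglyMeasurable (by fun_prop)
  · have := hc ⟨hs0, hsb⟩ p
    exact Continuous.intervalIntegrable (by fun_prop) _ _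
  · have := hc ⟨hs0, hsb⟩ (p - 1)
    exact Continuous.aestronglyMeasurable (by fun_prop)
  · refine Filter.Eventually.of_forall fun θ hθ t ht => ?_
    rw [Set.uIoc_of_le pi_pos.le] at hθ
    exact hC (t, θ) ⟨⟨ht.1.le, ht.2.le⟩, ⟨hθ.1.le, hθ.2⟩⟩
  · exact intervalIntegrable_const
  · refine Filter.Eventually.of_forall fun θ _ t ht => ?_
    have := ((((hasDerivAt_id t).mul_const (cos θ)).const_sub 1).rpow_const (p := p)
      (Or.inl (one_sub_mul_cos_pos ht.1.le (ht.2.trans hb1) θ).ne')).const_mul (sin θ ^ 2)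
    refine this.congr_deriv ?_
    simp only [id]
    ring

lemma hasDerivAt_sq_mul_integral_sin_sq_rpow {s : ℝ} (hs0 : 0 < s) (hs1 : s < 1) (p : ℝ) :
    HasDerivAt (fun s => s ^ 2 / 2 * ∫ θ in (0 : ℝ)..π, sin θ ^ 2 * (1 - s * cos θ) ^ p)
      (s / 2 * ∫ θ in (0 : ℝ)..π, (1 - s * cos θ) ^ p) s := by
  have hc := continuous_one_sub_mul_cos_rpow hs0.le hs1
  have hp := hc p
  have hp' := hc (p - 1)
  refine (((hasDerivAt_pow 2 s).div_const 2).mul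
    (hasDerivAt_integral_sin_sq_rpow hs0 hs1 p)).congr_deriv (Eq.symm ?_)
  have key := integral_sin_sq_mul_cos_rpow hs0.le hs1 p
  refine sub_eq_zero.1 (Eq.trans ?_ (mul_eq_zero_of_right (s / 2) key))
  simp only [← integral_const_mul]
  rw [← integral_add, ← integral_sub]
  · refine integral_congr fun θ _ => ?_
    simp only [cos_sq']
    push_cast
    ring
  all_goals exact Continuous.intervalIntegrable (by fun_prop) _ _

/-- The derivative of `Ibar k` as a trigonometric integral. -/
lemma hasDerivAt_Ibar (k : ℕ) {h : ℝ} (hh : h ∈ Set.Ioo (-1 : ℝ) 0) :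
    HasDerivAt (Ibar k)
      (1 / 4 * ∫ θ in (0 : ℝ)..π, (1 - √(1 + h) * cos θ) ^ (((k : ℝ) - 1) / 2)) h := by
  have hpos : 0 < 1 + h := by linarith [hh.1]
  have hs0 : 0 < √(1 + h) := sqrt_pos.2 hpos
  have hs1 : √(1 + h) < 1 := by
    rw [sqrt_lt' one_pos]; linarith [hh.2]
  have hsqrt : HasDerivAt (fun h : ℝ => √(1 + h)) (1 / (2 * √(1 + h))) h :=
    ((hasDerivAt_id h).const_add 1).sqrt hpos.ne'
  have := (hasDerivAt_sq_mul_integral_sin_sq_rpow hs0 hs1 (((k : ℝ) - 1) / 2)).comp h hsqrt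
  refine (this.congr_of_eventuallyEq ?_).congr_deriv ?_
  · filter_upwards [Ioo_mem_nhds hh.1 hh.2] with t ht using Ibar_eq_integral_sin_sq k ht
  · field_simp
    ring

/-- For every `h ∈ (−1,0)`,
`Ī₀′(h) = (1/4) ∫_0^π (1 − √(1+h) cos θ)^{−1/2} dθ` and
`Ī₂′(h) = (1/4) ∫_0^π (1 − √(1+h) cos θ)^{1/2} dθ`. -/
theorem stmt7 :
    ∀ h ∈ Set.Ioo (-1 : ℝ) 0,
      HasDerivAt (Ibar 0)
        ((1 / 4) * ∫ θ in (0 : ℝ)..Real.pi,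
          (1 - Real.sqrt (1 + h) * Real.cos θ) ^ (-(1 : ℝ) / 2)) h ∧
      HasDerivAt (Ibar 2)
        ((1 / 4) * ∫ θ in (0 : ℝ)..Real.pi,
          Real.sqrt (1 - Real.sqrt (1 + h) * Real.cos θ)) h := by
  intro h hh
  refine ⟨?_, ?_⟩
  · convert hasDerivAt_Ibar 0 hh using 6
    norm_num
  · convert hasDerivAt_Ibar 2 hh using 4
    rw [sqrt_eq_rpow]
    norm_num
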